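/- Let F : ℙ → ℙ be a function such that for every finite non-empty s ⊆ ℕ, F(s) is non-empty and max(s) ≤ min(F(s)). Then F is not (𝒰 ∪ 𝒫)-definable. -/

import Mathlib

noncomputable section
open Classical

/-- `s ⊕ t`: lifted addition on sets of naturals. -/
def setPlus (s t : Set ℕ) : Set ℕ := {u | ∃ m ∈ s, ∃ n ∈ t, u = m + n}

/-- `s ⊗ t`: lifted multiplication on sets of naturals. -/
def setTimes (s t : Set ℕ) : Set ℕ := {u | ∃ m ∈ s, ∃ n ∈ t, u = m * n}

/-- Sets of naturals definable by (variable-free) arithmetic circuits: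
the smallest collection containing `∅`, `ℕ`, all singletons, closed under
union, intersection, complement, `⊕` and `⊗`. -/
inductive ArithDefinable : Set ℕ → Prop
  | empty : ArithDefinable ∅
  | univ : ArithDefinable Set.univ
  | single (k : ℕ) : ArithDefinable {k}
  | union : ∀ {s t : Set ℕ}, ArithDefinable s → ArithDefinable t → ArithDefinable (s ∪ t)
  | inter : ∀ {s t : Set ℕ}, ArithDefinable s → ArithDefinable t → ArithDefinable (s ∩ t)
  | compl : ∀ {s : Set ℕ}, ArithDefinable s → ArithDefinable sᶜ
  | plus : ∀ {s t : Set ℕ}, ArithDefinable s → ArithDefinable t → ArithDefinable (setPlus s t)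
  | times : ∀ {s t : Set ℕ}, ArithDefinable s → ArithDefinable t → ArithDefinable (setTimes s t)

/-- A set-function of arity `k`. -/
abbrev SetFun (k : ℕ) := (Fin k → Set ℕ) → Set ℕ

/-- The `𝒪`-definable functions `ℙ^n → ℙ`, for a collection `O` of set-functions
(given per arity): smallest class containing projections and the constants
`∅`, `ℕ`, `{k}`, closed under pointwise union, intersection, complement, and
composition with functions in `O`. -/
inductive ODef (O : ∀ k, Set (SetFun k)) (n : ℕ) : SetFun n → Prop
  | proj (i : Fin n) : ODef O n (fun s => s i)
  | empty : ODef O n (fun _ => ∅)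
  | univ : ODef O n (fun _ => Set.univ)
  | single (k : ℕ) : ODef O n (fun _ => {k})
  | union : ∀ {F G : SetFun n}, ODef O n F → ODef O n G → ODef O n (fun s => F s ∪ G s)
  | inter : ∀ {F G : SetFun n}, ODef O n F → ODef O n G → ODef O n (fun s => F s ∩ G s)
  | compl : ∀ {F : SetFun n}, ODef O n F → ODef O n (fun s => (F s)ᶜ)
  | comp : ∀ {k : ℕ} {g : SetFun k} {F : Fin k → SetFun n},
      g ∈ O k → (∀ i, ODef O n (F i)) → ODef O n (fun s => g (fun i => F i s))

/-- `s_{|m} = s ∩ {0,…,m}`. -/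
def restrict (s : Set ℕ) (m : ℕ) : Set ℕ := s ∩ {k | k ≤ m}

/-- `F` is `h`-continuous on `D`. -/
def HCont (h : ℕ → ℕ) {n : ℕ} (F : SetFun n) (D : Set (Fin n → Set ℕ)) : Prop :=
  ∀ m : ℕ, ∀ s ∈ D, ∀ t ∈ D,
    (∀ i, restrict (s i) (h m) = restrict (t i) (h m)) →
    restrict (F s) m = restrict (F t) m

/-- `F` is uniformly continuous on `D`. -/
def UnifCont {n : ℕ} (F : SetFun n) (D : Set (Fin n → Set ℕ)) : Prop :=
  ∃ h : ℕ → ℕ, HCont h F D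

/-- `𝒰`: set-functions (of arity `k`) uniformly continuous on the whole space. -/
def Ucal (k : ℕ) : Set (SetFun k) := {g | UnifCont g Set.univ}

/-- `𝒫`: predicates, i.e. set-functions with values among `∅` and `{0}`. -/
def Pcal (k : ℕ) : Set (SetFun k) := {g | ∀ s, g s = ∅ ∨ g s = {0}}

/-- `𝒰 ∪ 𝒫`. -/
def UPcal (k : ℕ) : Set (SetFun k) := Ucal k ∪ Pcal k

/-- `Max(x)`. -/
def MaxFun (x : Set ℕ) : Set ℕ :=
  if x = ∅ then ∅ else if x.Infinite then Set.univ else {sSup x}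

/-- `Card(x)`. -/
def CardFun (x : Set ℕ) : Set ℕ := if x.Finite then {x.ncard} else Set.univ

/-- `↓(x)`. -/
def DownFun (x : Set ℕ) : Set ℕ := {m | ∃ n ∈ x, m ≤ n}

/-- `Sum(x)`. -/
def SumFun (x : Set ℕ) : Set ℕ := if x.Finite then {∑ᶠ n ∈ x, n} else Set.univ

/-- `Prod(x)`. -/
def ProdFun (x : Set ℕ) : Set ℕ := if x.Finite then {∏ᶠ n ∈ x, n} else Set.univ

/-- `Shove(x) = {n - min x : n ∈ x}` (empty for `x = ∅`). -/
def ShoveFun (x : Set ℕ) : Set ℕ := (fun n => n - sInf x) '' x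

/-- `ε(x)`: the test for emptiness. -/
def epsFun (x : Set ℕ) : Set ℕ := if x = ∅ then {0} else ∅

/-- `Fin(x)`: the test for finiteness. -/
def FinFun (x : Set ℕ) : Set ℕ := if x.Finite then {0} else ∅

/-- `⊕` as a set-function of arity 2. -/
def plusFun : SetFun 2 := fun s => setPlus (s 0) (s 1)

/-- `⊗` as a set-function of arity 2. -/
def timesFun : SetFun 2 := fun s => setTimes (s 0) (s 1)

/-- `↓` as a set-function of arity 1. -/
def downFun1 : SetFun 1 := fun s => DownFun (s 0)

/-- `ε` as a set-function of arity 1. -/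
def epsFun1 : SetFun 1 := fun s => epsFun (s 0)

/-- The collection `{⊕, ⊗}`. -/
def arithO : ∀ k, Set (SetFun k)
  | 2 => {plusFun, timesFun}
  | _ => ∅

/-- The collection `{⊕}`. -/
def addO : ∀ k, Set (SetFun k)
  | 2 => {plusFun}
  | _ => ∅

/-- The collection `{⊕, ↓} ∪ 𝒫`. -/
def addDownO : ∀ k, Set (SetFun k)
  | 1 => insert downFun1 (Pcal 1)
  | 2 => insert plusFun (Pcal 2)
  | k => Pcal k

/-- The collection `{⊕, ⊗, ↓} ∪ 𝒫`. -/
def arithDownO : ∀ k, Set (SetFun k)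
  | 1 => insert downFun1 (Pcal 1)
  | 2 => {plusFun, timesFun} ∪ Pcal 2
  | k => Pcal k

/-- The collection `𝒰 ∪ {ε}`. -/
def UEps : ∀ k, Set (SetFun k)
  | 1 => insert epsFun1 (Ucal 1)
  | k => Ucal k

/-- The collection `{⊕, ⊗} ∪ 𝒫`. -/
def arithPO (k : ℕ) : Set (SetFun k) := arithO k ∪ Pcal k

/-- A numerical function `ℕ → ℕ` is `O`-definable if some `O`-definable
set-function maps `{m}` to `{f m}` for every `m`. -/
def NumDef1 (O : ∀ k, Set (SetFun k)) (f : ℕ → ℕ) : Prop :=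
  ∃ F : SetFun 1, ODef O 1 F ∧ ∀ m : ℕ, F (fun _ => {m}) = {f m}

/-- A numerical function `ℕ^k → ℕ` is `O`-definable if some `O`-definable
set-function maps tuples of singletons to the corresponding singleton value. -/
def NumDef (O : ∀ k, Set (SetFun k)) (k : ℕ) (f : (Fin k → ℕ) → ℕ) : Prop :=
  ∃ F : SetFun k, ODef O k F ∧ ∀ m : Fin k → ℕ, F (fun i => ({m i} : Set ℕ)) = {f m}

/-- `f` is regressive: `{f n : f n < n}` is infinite. -/
def Regressive (f : ℕ → ℕ) : Prop := {y | ∃ n, f n = y ∧ y < n}.Infinite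

/-- `f` is semi-regressive: for every `ℓ` there is `n` with `n + ℓ ≤ f n ≤ 2n - 2`. -/
def SemiRegressive (f : ℕ → ℕ) : Prop :=
  ∀ ℓ : ℕ, ∃ n : ℕ, n + ℓ ≤ f n ∧ (f n : ℤ) ≤ 2 * (n : ℤ) - 2

theorem restrict_eq_iff {s t : Set ℕ} {m : ℕ} :
    restrict s m = restrict t m ↔ ∀ k ≤ m, (k ∈ s ↔ k ∈ t) := by
  simp only [restrict, Set.ext_iff, Set.mem_inter_iff, Set.mem_ofPred_eq]
  exact forall_congr' fun k => by tauto

theorem restrict_eq_of_le {s t : Set ℕ} {m n : ℕ} (hmn : m ≤ n)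
    (h : restrict s n = restrict t n) : restrict s m = restrict t m :=
  restrict_eq_iff.2 fun k hk => restrict_eq_iff.1 h k (hk.trans hmn)

/-- `F` is uniformly continuous, with a common modulus, on each piece of a finite partition. -/
def PiecewiseUnifCont {n : ℕ} (F : SetFun n) : Prop :=
  ∃ (ι : Type) (_ : Finite ι) (c : (Fin n → Set ℕ) → ι) (h : ℕ → ℕ),
    ∀ i, HCont h F (c ⁻¹' {i})

theorem UnifCont.piecewiseUnifCont {n : ℕ} {F : SetFun n} (hF : UnifCont F Set.univ) :
    PiecewiseUnifCont F := by
  obtain ⟨h, hh⟩ := hF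
  exact ⟨Unit, inferInstance, fun _ => (), h, fun _ m s _ t _ => hh m s trivial t trivial⟩

theorem piecewiseUnifCont_const {n : ℕ} (a : Set ℕ) :
    PiecewiseUnifCont (fun _ : Fin n → Set ℕ => a) :=
  UnifCont.piecewiseUnifCont ⟨id, fun _ _ _ _ _ _ => rfl⟩

theorem piecewiseUnifCont_of_mem_Pcal {k n : ℕ} {g : SetFun k} (hg : g ∈ Pcal k)
    (F : Fin k → SetFun n) : PiecewiseUnifCont (fun s => g (fun i => F i s)) := by
  refine ⟨Prop, inferInstance, fun s => g (fun i => F i s) = ∅, id, fun i m s hs t ht _ => ?_⟩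
  have hst : (g (fun i => F i s) = ∅) = (g (fun i => F i t) = ∅) :=
    Eq.trans (b := i) hs (Eq.symm ht)
  rcases hg (fun i => F i s) with h1 | h1 <;> rcases hg (fun i => F i t) with h2 | h2 <;>
    simp_all

theorem UnifCont.piecewiseUnifCont_comp {k n : ℕ} {g : SetFun k} (hg : UnifCont g Set.univ)
    {F : Fin k → SetFun n} (hF : ∀ i, PiecewiseUnifCont (F i)) :
    PiecewiseUnifCont (fun s => g (fun i => F i s)) := by
  obtain ⟨h, hh⟩ := hg
  choose ι hι c hc H using hF
  refine ⟨∀ i, ι i, inferInstance, fun s i => c i s,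
    fun m => Finset.univ.sup fun i => hc i (h m), fun p m s hs t ht hst => ?_⟩
  refine hh m _ trivial _ trivial fun i => ?_
  refine H i (p i) (h m) s (congrFun hs i) t (congrFun ht i) fun j => ?_
  exact restrict_eq_of_le (Finset.le_sup (f := fun i => hc i (h m)) (Finset.mem_univ i)) (hst j)

theorem unifCont_union : UnifCont (fun s : Fin 2 → Set ℕ => s 0 ∪ s 1) Set.univ := by
  refine ⟨id, fun m s _ t _ h => restrict_eq_iff.2 fun k hk => ?_⟩
  exact or_congr (restrict_eq_iff.1 (h 0) k hk) (restrict_eq_iff.1 (h 1) k hk)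

theorem unifCont_inter : UnifCont (fun s : Fin 2 → Set ℕ => s 0 ∩ s 1) Set.univ := by
  refine ⟨id, fun m s _ t _ h => restrict_eq_iff.2 fun k hk => ?_⟩
  exact and_congr (restrict_eq_iff.1 (h 0) k hk) (restrict_eq_iff.1 (h 1) k hk)

theorem unifCont_compl : UnifCont (fun s : Fin 1 → Set ℕ => (s 0)ᶜ) Set.univ := by
  refine ⟨id, fun m s _ t _ h => restrict_eq_iff.2 fun k hk => ?_⟩
  exact not_congr (restrict_eq_iff.1 (h 0) k hk)

theorem ODef.piecewiseUnifCont {n : ℕ} {F : SetFun n} (hF : ODef UPcal n F) :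
    PiecewiseUnifCont F := by
  induction hF with
  | proj i => exact UnifCont.piecewiseUnifCont ⟨id, fun _ _ _ _ _ h => h i⟩
  | empty => exact piecewiseUnifCont_const _
  | univ => exact piecewiseUnifCont_const _
  | single k => exact piecewiseUnifCont_const _
  | @union F G _ _ hF hG =>
    exact unifCont_union.piecewiseUnifCont_comp (F := ![F, G]) (Fin.forall_fin_two.2 ⟨hF, hG⟩)
  | @inter F G _ _ hF hG =>
    exact unifCont_inter.piecewiseUnifCont_comp (F := ![F, G]) (Fin.forall_fin_two.2 ⟨hF, hG⟩)
  | @compl F _ hF => exact unifCont_compl.piecewiseUnifCont_comp (F := fun _ => F) fun _ => hF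
  | comp hg _ ih =>
    rcases hg with hg | hg
    · exact UnifCont.piecewiseUnifCont_comp hg ih
    · exact piecewiseUnifCont_of_mem_Pcal hg _

/-- Iterated insertion into `{0}` of the new element `b s` chosen from the current set `s`. -/
def insertSeq (b : Finset ℕ → ℕ) : ℕ → Finset ℕ
  | 0 => {0}
  | k + 1 => insert (b (insertSeq b k)) (insertSeq b k)

theorem insertSeq_nonempty (b : Finset ℕ → ℕ) (k : ℕ) : (insertSeq b k).Nonempty := by
  cases k <;> simp [insertSeq]

theorem insertSeq_mono (b : Finset ℕ → ℕ) : Monotone (insertSeq b) :=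
  monotone_nat_of_le_succ fun _ => Finset.subset_insert _ _

theorem mem_insertSeq_of_lt (b : Finset ℕ → ℕ) {i j : ℕ} (hij : i < j) :
    b (insertSeq b i) ∈ insertSeq b j :=
  insertSeq_mono b hij (Finset.mem_insert_self _ _)

theorem mem_or_le_of_mem_insertSeq {b : Finset ℕ → ℕ} (hb : ∀ s, ∀ x ∈ s, x ≤ b s)
    {i j : ℕ} (hij : i ≤ j) {x : ℕ} (hx : x ∈ insertSeq b j) :
    x ∈ insertSeq b i ∨ b (insertSeq b i) ≤ x := by
  induction j, hij using Nat.le_induction with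
  | base => exact Or.inl hx
  | succ j hij ih =>
    rcases Finset.mem_insert.1 hx with rfl | hx
    · rcases hij.eq_or_lt with rfl | hlt
      · exact Or.inr le_rfl
      · exact Or.inr (hb _ _ (mem_insertSeq_of_lt b hlt))
    · exact ih hx

theorem fast_growing_not_UP_definable (F : Set ℕ → Set ℕ)
    (hF : ∀ s : Set ℕ, s.Finite → s.Nonempty → (F s).Nonempty ∧ sSup s ≤ sInf (F s)) :
    ¬ ODef UPcal 1 (fun v => F (v 0)) := by
  intro hdef
  obtain ⟨ι, _, c, h, H⟩ := hdef.piecewiseUnifCont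
  let b : Finset ℕ → ℕ := fun s => s.sup id + sInf (F s) + h (sInf (F s)) + 1
  have hb : ∀ s : Finset ℕ, ∀ x ∈ s, x ≤ b s := fun s x hx => by
    have : x ≤ s.sup id := Finset.le_sup (f := id) hx
    grind
  obtain ⟨i, j, hne, hc⟩ :=
    Finite.exists_ne_map_eq_of_infinite fun k => c fun _ => (insertSeq b k : Set ℕ)
  wlog hij : i < j generalizing i j
  · exact this j i hne.symm hc.symm (by omega)
  have hFi := hF (insertSeq b i) (Finset.finite_toSet _) (insertSeq_nonempty b i)
  have hFj := hF (insertSeq b j) (Finset.finite_toSet _) (insertSeq_nonempty b j)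
  have hagree := H _ (sInf (F (insertSeq b i))) _ hc _ rfl fun _ =>
    restrict_eq_iff.2 fun k hk => ⟨fun hx => insertSeq_mono b hij.le hx, fun hx =>
      (mem_or_le_of_mem_insertSeq hb hij.le hx).resolve_right (by grind)⟩
  have hmem := (restrict_eq_iff.1 hagree _ le_rfl).1 (Nat.sInf_mem hFi.1)
  have hle : b (insertSeq b i) ≤ sSup (insertSeq b j : Set ℕ) :=
    le_csSup (Finset.bddAbove _) (mem_insertSeq_of_lt b hij)
  have hge := (hle.trans hFj.2).trans (Nat.sInf_le hmem)
  grind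

end
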